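/- arXiv:1609.05666 — 5 statements merged into one kernel-verified Lean document; each statement's English description precedes it below -/
import Mathlib

section
/- Let (ℰ,𝓕) be a resistance form on a nonempty set F with resistance metric R, and fix ρ ∈ F. Then lim_{r→∞} R(ρ, B_R(ρ,r)ᶜ) = +∞ if and only if there exists a sequence (f_n) in 𝓕 such that each f_n vanishes outside some ball B_R(ρ, r_n), ℰ(f_n,f_n) → 0, and f_n(ρ) → 1. (This is the analytic reformulation of the paper's characterisation of recurrence: the associated Dirichlet form is recurrent precisely when the resistance from ρ to the complements of large balls tends to infinity.) -/
open Filter Topology MeasureTheory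
open scoped ENNReal

/-- A resistance form `(ℰ,𝓕)` on a nonempty set `F`:
`dom` is a linear subspace of `F → ℝ` containing the constants, and `energy`
is a nonnegative symmetric bilinear form satisfying RF1–RF5. -/
structure ResistanceForm (F : Type*) where
  dom : Set (F → ℝ)
  energy : (F → ℝ) → (F → ℝ) → ℝ
  const_mem : ∀ c : ℝ, (fun _ => c) ∈ dom
  add_mem : ∀ f ∈ dom, ∀ g ∈ dom, f + g ∈ dom
  smul_mem : ∀ (c : ℝ), ∀ f ∈ dom, c • f ∈ dom
  symm : ∀ f g, energy f g = energy g f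
  add_left : ∀ f g h, energy (f + g) h = energy f h + energy g h
  smul_left : ∀ (c : ℝ) (f g), energy (c • f) g = c * energy f g
  nonneg : ∀ f ∈ dom, 0 ≤ energy f f
  -- RF1: `ℰ(f,f) = 0` iff `f` is constant
  rf1 : ∀ f ∈ dom, (energy f f = 0 ↔ ∃ c : ℝ, ∀ x, f x = c)
  -- RF2: the quotient of `dom` by the constants is complete (hence a Hilbert space)
  rf2 : ∀ f : ℕ → F → ℝ, (∀ n, f n ∈ dom) →
    (∀ ε > (0:ℝ), ∃ N, ∀ m ≥ N, ∀ n ≥ N, energy (f m - f n) (f m - f n) < ε) →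
    ∃ g ∈ dom, Tendsto (fun n => energy (f n - g) (f n - g)) atTop (𝓝 0)
  -- RF3: `dom` separates points
  rf3 : ∀ x y : F, x ≠ y → ∃ f ∈ dom, f x ≠ f y
  -- RF4: the resistance between two points is finite
  rf4 : ∀ x y : F,
    BddAbove {r : ℝ | ∃ f ∈ dom, 0 < energy f f ∧ r = |f x - f y| ^ 2 / energy f f}
  -- RF5: the Markov property
  rf5 : ∀ f ∈ dom, (fun x => max (min (f x) 1) 0) ∈ dom ∧
    energy (fun x => max (min (f x) 1) 0) (fun x => max (min (f x) 1) 0) ≤ energy f f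

namespace ResistanceForm

variable {F : Type*} (Φ : ResistanceForm F)

/-- The resistance metric `R(x,y)`. -/
noncomputable def Rmet (x y : F) : ℝ :=
  sSup {r : ℝ | ∃ f ∈ Φ.dom, 0 < Φ.energy f f ∧ r = |f x - f y| ^ 2 / Φ.energy f f}

/-- The effective resistance `R(x,A)` between a point and a set, valued in `[0,∞]`,
with `sInf ∅ = ∞`, `∞⁻¹ = 0` and `0⁻¹ = ∞`. -/
noncomputable def resToSet (x : F) (A : Set F) : ℝ≥0∞ :=
  (sInf {e : ℝ≥0∞ | ∃ f ∈ Φ.dom, f x = 1 ∧ (∀ y ∈ A, f y = 0) ∧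
    e = ENNReal.ofReal (Φ.energy f f)})⁻¹

/-- The open ball of radius `r` about `x` in the resistance metric. -/
def ball (x : F) (r : ℝ) : Set F := {y | Φ.Rmet x y < r}

end ResistanceForm

namespace ResistanceForm

variable {F : Type*} (Φ : ResistanceForm F)

lemma energy_smul_smul (c : ℝ) (f : F → ℝ) :
    Φ.energy (c • f) (c • f) = c ^ 2 * Φ.energy f f := by
  rw [Φ.smul_left, Φ.symm, Φ.smul_left]
  ring

lemma compl_ball_antitone (x : F) : Antitone fun r : ℝ => (Φ.ball x r)ᶜ :=
  fun _ _ h => Set.compl_subset_compl.2 fun _ hy => lt_of_lt_of_le hy h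

/-- The effective resistance between `x` and `A` is at least `f(x)² / ℰ(f,f)` for every
`f` vanishing on `A` with `f(x) ≠ 0`. -/
lemma inv_resToSet_le {x : F} {A : Set F} {f : F → ℝ} (hf : f ∈ Φ.dom) (hx : f x ≠ 0)
    (hA : ∀ y ∈ A, f y = 0) :
    (Φ.resToSet x A)⁻¹ ≤ ENNReal.ofReal ((f x)⁻¹ ^ 2 * Φ.energy f f) := by
  rw [resToSet, inv_inv]
  refine sInf_le ⟨(f x)⁻¹ • f, Φ.smul_mem _ f hf, ?_, fun y hy => ?_, ?_⟩
  · simp [hx]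
  · simp [hA y hy]
  · rw [energy_smul_smul]

/-- A bound on the effective resistance from below is witnessed by a function of small energy. -/
lemma exists_energy_lt_of_inv_resToSet_lt {x : F} {A : Set F} {ε : ℝ}
    (h : (Φ.resToSet x A)⁻¹ < ENNReal.ofReal ε) :
    ∃ f ∈ Φ.dom, f x = 1 ∧ (∀ y ∈ A, f y = 0) ∧ Φ.energy f f < ε := by
  rw [resToSet, inv_inv] at h
  obtain ⟨_, ⟨f, hf, hx, hA, rfl⟩, hlt⟩ := sInf_lt_iff.1 h
  exact ⟨f, hf, hx, hA, (ENNReal.ofReal_lt_ofReal_iff_of_nonneg (Φ.nonneg f hf)).1 hlt⟩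

end ResistanceForm

/-- `R(ρ, B_R(ρ,r)ᶜ) → ∞` as `r → ∞` if and only if there is a sequence
`(f_n)` in `𝓕`, each vanishing outside some resistance ball around `ρ`, with
`ℰ(f_n,f_n) → 0` and `f_n(ρ) → 1`. -/
theorem resistance_growth_iff_recurrence_sequence
    {F : Type*} [Nonempty F] (Φ : ResistanceForm F) (ρ : F) :
    Tendsto (fun r : ℝ => Φ.resToSet ρ (Φ.ball ρ r)ᶜ) atTop (𝓝 (⊤ : ℝ≥0∞)) ↔
      ∃ f : ℕ → F → ℝ, (∀ n, f n ∈ Φ.dom) ∧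
        (∀ n, ∃ r : ℝ, ∀ y ∈ (Φ.ball ρ r)ᶜ, f n y = 0) ∧
        Tendsto (fun n => Φ.energy (f n) (f n)) atTop (𝓝 0) ∧
        Tendsto (fun n => f n ρ) atTop (𝓝 1) := by
  rw [← tendsto_inv_iff, ENNReal.inv_top]
  constructor
  · intro h
    have key : ∀ n : ℕ, ∃ f ∈ Φ.dom, (∃ r : ℝ, ∀ y ∈ (Φ.ball ρ r)ᶜ, f y = 0) ∧
        Φ.energy f f < 1 / ((n : ℝ) + 1) ∧ f ρ = 1 := fun n => by
      have hpos : 0 < ENNReal.ofReal (1 / ((n : ℝ) + 1)) :=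
        ENNReal.ofReal_pos.2 Nat.one_div_pos_of_nat
      obtain ⟨r, hr⟩ := (h.eventually_lt_const hpos).exists
      obtain ⟨f, hf, hρ, hA, hE⟩ := Φ.exists_energy_lt_of_inv_resToSet_lt hr
      exact ⟨f, hf, ⟨r, hA⟩, hE, hρ⟩
    choose f hf hA hE hρ using key
    refine ⟨f, hf, hA, ?_, by simp [hρ]⟩
    exact squeeze_zero (fun n => Φ.nonneg _ (hf n)) (fun n => (hE n).le)
      tendsto_one_div_add_atTop_nhds_zero_nat
  · rintro ⟨f, hf, hA, hE, hρ⟩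
    have hlim : Tendsto (fun n => ENNReal.ofReal ((f n ρ)⁻¹ ^ 2 * Φ.energy (f n) (f n)))
        atTop (𝓝 0) := by
      simpa using ENNReal.tendsto_ofReal (((hρ.inv₀ one_ne_zero).pow 2).mul hE)
    rw [ENNReal.tendsto_nhds_zero]
    intro ε hε
    obtain ⟨n, hn, hn0⟩ :=
      ((hlim.eventually_le_const hε).and (hρ.eventually_ne one_ne_zero)).exists
    obtain ⟨r, hr⟩ := hA n
    filter_upwards [eventually_ge_atTop r] with s hs
    exact (Φ.inv_resToSet_le (hf n) hn0
      fun y hy => hr y (Φ.compl_ball_antitone ρ hs hy)).trans hn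
end

section
/- Let (ℰ,𝓕) be a resistance form on a nonempty set F with resistance metric R, and fix ρ ∈ F. If lim_{r→∞} R(ρ, B_R(ρ,r)ᶜ) = +∞, then there exist radii r_n → ∞ and functions f_n ∈ 𝓕 such that f_n(ρ) = 1, f_n ≡ 0 on B_R(ρ,r_n)ᶜ, ℰ(f_n,f_n) → 0, and f_n(x) → 1 for every x ∈ F. -/
open Filter Topology MeasureTheory
open scoped ENNReal

/-- A point evaluation difference is controlled by the square root of the energy. -/
theorem ResistanceForm.exists_sq_sub_le_mul_energy {F : Type*} (Φ : ResistanceForm F) (x y : F) :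
    ∃ K : ℝ, ∀ f ∈ Φ.dom, (f x - f y) ^ 2 ≤ K * Φ.energy f f := by
  obtain ⟨K, hK⟩ := Φ.rf4 x y
  refine ⟨K, fun f hf => ?_⟩
  rcases (Φ.nonneg f hf).eq_or_lt with h0 | hpos
  · obtain ⟨c, hc⟩ := (Φ.rf1 f hf).1 h0.symm
    simp [hc, ← h0]
  · have := hK ⟨f, hf, hpos, rfl⟩
    rwa [div_le_iff₀ hpos, sq_abs] at this

/-- If the effective resistance from `x` to `A` exceeds `c⁻¹`, some admissible function has energy
less than `c`. -/
theorem ResistanceForm.exists_energy_lt_of_lt_resToSet {F : Type*} (Φ : ResistanceForm F)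
    {x : F} {A : Set F} {c : ℝ} (h : (ENNReal.ofReal c)⁻¹ < Φ.resToSet x A) :
    ∃ f ∈ Φ.dom, f x = 1 ∧ (∀ y ∈ A, f y = 0) ∧ Φ.energy f f < c := by
  rw [resToSet, ENNReal.inv_lt_inv, sInf_lt_iff] at h
  obtain ⟨_, ⟨f, hf, hx, hA, rfl⟩, hlt⟩ := h
  exact ⟨f, hf, hx, hA, (ENNReal.ofReal_lt_ofReal_iff'.1 hlt).1⟩

/-- if `R(ρ, B_R(ρ,r)ᶜ) → ∞` as `r → ∞`, then there exist radii `r_n → ∞`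
and `f_n ∈ 𝓕` with `f_n(ρ) = 1`, `f_n ≡ 0` on `B_R(ρ,r_n)ᶜ`, `ℰ(f_n,f_n) → 0`, and
`f_n(x) → 1` for every `x ∈ F`. -/
theorem exists_cutoff_sequence_of_resistance_growth
    {F : Type*} [Nonempty F] (Φ : ResistanceForm F) (ρ : F)
    (h : Tendsto (fun r : ℝ => Φ.resToSet ρ (Φ.ball ρ r)ᶜ) atTop (𝓝 (⊤ : ℝ≥0∞))) :
    ∃ (r : ℕ → ℝ) (f : ℕ → F → ℝ),
      Tendsto r atTop atTop ∧
      (∀ n, f n ∈ Φ.dom) ∧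
      (∀ n, f n ρ = 1) ∧
      (∀ n, ∀ y ∈ (Φ.ball ρ (r n))ᶜ, f n y = 0) ∧
      Tendsto (fun n => Φ.energy (f n) (f n)) atTop (𝓝 0) ∧
      (∀ x : F, Tendsto (fun n => f n x) atTop (𝓝 1)) := by
  have key (n : ℕ) : ∃ (r : ℝ) (f : F → ℝ), (n : ℝ) ≤ r ∧ f ∈ Φ.dom ∧ f ρ = 1 ∧
      (∀ y ∈ (Φ.ball ρ r)ᶜ, f y = 0) ∧ Φ.energy f f < 1 / ((n : ℝ) + 1) := by
    have hc : (ENNReal.ofReal (1 / ((n : ℝ) + 1)))⁻¹ < ⊤ :=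
      ENNReal.inv_lt_top.2 (ENNReal.ofReal_pos.2 (by positivity))
    obtain ⟨r, hr, hnr⟩ := ((h.eventually_const_lt hc).and (eventually_ge_atTop (n : ℝ))).exists
    obtain ⟨f, hf⟩ := Φ.exists_energy_lt_of_lt_resToSet hr
    exact ⟨r, f, hnr, hf⟩
  choose r f hr hf hρ hzero hlt using key
  have hE : Tendsto (fun n => Φ.energy (f n) (f n)) atTop (𝓝 0) :=
    squeeze_zero (fun n => Φ.nonneg _ (hf n)) (fun n => (hlt n).le)
      tendsto_one_div_add_atTop_nhds_zero_nat
  refine ⟨r, f, tendsto_atTop_mono hr tendsto_natCast_atTop_atTop, hf, hρ, hzero, hE, fun x => ?_⟩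
  obtain ⟨K, hK⟩ := Φ.exists_sq_sub_le_mul_energy x ρ
  have hsq : Tendsto (fun n => (f n x - 1) ^ 2) atTop (𝓝 0) :=
    squeeze_zero (fun n => sq_nonneg _) (fun n => by simpa [hρ n] using hK (f n) (hf n))
      (by simpa using hE.const_mul K)
  have habs : Tendsto (fun n => |f n x - 1|) atTop (𝓝 0) := by
    simpa [Real.sqrt_sq_eq_abs] using hsq.sqrt
  simpa using ((tendsto_zero_iff_abs_tendsto_zero _).2 habs).add_const 1
end

section
/- Let (ℰ,𝓕) be a resistance form on a nonempty set F whose resistance metric R makes (F,R) a compact metric space, and let U and W be disjoint nonempty compact subsets of F. Then there exist f ∈ 𝓕 and ε > 0 such that f ≡ 0 on W, f ≡ ε on U, and 0 ≤ f(z) ≤ ε for all z ∈ F. -/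
open Filter Topology MeasureTheory
open scoped ENNReal

namespace ResistanceForm

variable {F : Type*} (Φ : ResistanceForm F)

/-- `R_A(y,z)`: the resistance between `y` and `z` in the network with `A` fused,
`sup{ ℰ(f,f)⁻¹ : f ∈ 𝓕, f(y) = 1, f(z) = 0, f constant on A }` (with `sSup ∅ = 0`). -/
noncomputable def fusedRes (A : Set F) (y z : F) : ℝ :=
  sSup {r : ℝ | ∃ f ∈ Φ.dom, f y = 1 ∧ f z = 0 ∧
    (∀ a ∈ A, ∀ b ∈ A, f a = f b) ∧ r = (Φ.energy f f)⁻¹}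

/-- The resolvent kernel `g_A(y,z) = (R(y,A) + R(z,A) - R_A(y,z))/2`. -/
noncomputable def resKernel (A : Set F) (y z : F) : ℝ :=
  ((Φ.resToSet y A).toReal + (Φ.resToSet z A).toReal - Φ.fusedRes A y z) / 2

/-- Regularity of a resistance form: `𝓕 ∩ C₀(F)` is dense in `C₀(F)` in the
supremum norm, where the topology on `F` is that of the resistance metric. -/
def Regular [MetricSpace F] : Prop :=
  ∀ g : F → ℝ, Continuous g → HasCompactSupport g → ∀ ε > (0:ℝ),
    ∃ f ∈ Φ.dom, Continuous f ∧ HasCompactSupport f ∧ ∀ x, |f x - g x| ≤ ε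

end ResistanceForm

namespace ResistanceForm

variable {F : Type*} (Φ : ResistanceForm F)

theorem sub_mem {f g : F → ℝ} (hf : f ∈ Φ.dom) (hg : g ∈ Φ.dom) : f - g ∈ Φ.dom := by
  have h := Φ.add_mem f hf _ (Φ.smul_mem (-1) g hg)
  rwa [neg_one_smul, ← sub_eq_add_neg] at h

theorem sq_abs_sub_le_Rmet_mul_energy {f : F → ℝ} (hf : f ∈ Φ.dom) (x y : F) :
    |f x - f y| ^ 2 ≤ Φ.Rmet x y * Φ.energy f f := by
  rcases (Φ.nonneg f hf).eq_or_lt with h | h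
  · obtain ⟨c, hc⟩ := (Φ.rf1 f hf).1 h.symm
    simp [hc, ← h]
  · rw [← div_le_iff₀ h]
    exact le_csSup (Φ.rf4 x y) ⟨f, hf, h, rfl⟩

theorem continuous_of_mem_dom [MetricSpace F] (hdist : ∀ x y : F, dist x y = Φ.Rmet x y)
    {f : F → ℝ} (hf : f ∈ Φ.dom) : Continuous f := by
  refine continuous_iff_continuousAt.2 fun x => ?_
  refine tendsto_iff_dist_tendsto_zero.2 ?_
  have hlim : Tendsto (fun y => √(dist y x * Φ.energy f f)) (𝓝 x) (𝓝 0) := by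
    have hc : Continuous fun y => √(dist y x * Φ.energy f f) := by fun_prop
    simpa using hc.tendsto x
  refine squeeze_zero (fun _ => dist_nonneg) (fun y => ?_) hlim
  rw [Real.dist_eq, hdist]
  exact Real.le_sqrt_of_sq_le (Φ.sq_abs_sub_le_Rmet_mul_energy hf y x)

theorem posPart_mem_of_le {f : F → ℝ} (hf : f ∈ Φ.dom) {M : ℝ} (hM : 0 < M)
    (hfM : ∀ x, f x ≤ M) : (fun x => max (f x) 0) ∈ Φ.dom := by
  have h := Φ.smul_mem M _ (Φ.rf5 _ (Φ.smul_mem M⁻¹ f hf)).1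
  convert h using 1
  funext x
  have h1 : M⁻¹ * f x ≤ 1 := by
    rw [inv_mul_le_iff₀ hM, mul_one]
    exact hfM x
  simp [min_eq_left h1, mul_max_of_nonneg _ _ hM.le, hM.ne']

theorem posPart_mem [MetricSpace F] [CompactSpace F]
    (hdist : ∀ x y : F, dist x y = Φ.Rmet x y) {f : F → ℝ}
    (hf : f ∈ Φ.dom) : (fun x => max (f x) 0) ∈ Φ.dom := by
  obtain ⟨M, hM⟩ := (isCompact_range (Φ.continuous_of_mem_dom hdist hf)).bddAbove
  exact Φ.posPart_mem_of_le hf (lt_max_of_lt_right one_pos)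
    fun x => (hM ⟨x, rfl⟩).trans (le_max_left M 1)

theorem max_mem [MetricSpace F] [CompactSpace F]
    (hdist : ∀ x y : F, dist x y = Φ.Rmet x y) {f g : F → ℝ}
    (hf : f ∈ Φ.dom) (hg : g ∈ Φ.dom) : (fun x => max (f x) (g x)) ∈ Φ.dom := by
  convert Φ.add_mem g hg _ (Φ.posPart_mem hdist (Φ.sub_mem hf hg)) using 1
  funext x
  simp [← max_add_add_left]

theorem min_mem [MetricSpace F] [CompactSpace F]
    (hdist : ∀ x y : F, dist x y = Φ.Rmet x y) {f g : F → ℝ}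
    (hf : f ∈ Φ.dom) (hg : g ∈ Φ.dom) : (fun x => min (f x) (g x)) ∈ Φ.dom := by
  convert Φ.sub_mem hf (Φ.posPart_mem hdist (Φ.sub_mem hf hg)) using 1
  funext x
  rcases le_total (f x) (g x) with h | h <;> simp [h]

theorem exists_mem_dom_eq_eq {x y : F} (hxy : x ≠ y) (a b : ℝ) :
    ∃ f ∈ Φ.dom, f x = a ∧ f y = b := by
  obtain ⟨g, hg, hgxy⟩ := Φ.rf3 x y hxy
  have hne : g x - g y ≠ 0 := sub_ne_zero.2 hgxy
  refine ⟨((a - b) / (g x - g y)) • (g - fun _ => g y) + fun _ => b,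
    Φ.add_mem _ (Φ.smul_mem _ _ (Φ.sub_mem hg (Φ.const_mem _))) _ (Φ.const_mem _), ?_, ?_⟩
  · simp [hne]
  · simp

theorem closure_setOf_mem_dom_eq_top [MetricSpace F] [CompactSpace F]
    (hdist : ∀ x y : F, dist x y = Φ.Rmet x y) :
    closure {g : C(F, ℝ) | ⇑g ∈ Φ.dom} = ⊤ := by
  refine ContinuousMap.sublattice_closure_eq_top _ ⟨0, Φ.const_mem 0⟩
    (fun f hf g hg => Φ.min_mem hdist hf hg) (fun f hf g hg => Φ.max_mem hdist hf hg) ?_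
  intro v x y
  obtain ⟨f, hf, hfx, hfy⟩ : ∃ f ∈ Φ.dom, f x = v x ∧ f y = v y := by
    rcases eq_or_ne x y with rfl | hxy
    · exact ⟨fun _ => v x, Φ.const_mem _, rfl, rfl⟩
    · exact Φ.exists_mem_dom_eq_eq hxy _ _
  exact ⟨⟨f, Φ.continuous_of_mem_dom hdist hf⟩, hf, hfx, hfy⟩

end ResistanceForm

/-- on a compact resistance metric space, disjoint nonempty compact sets
`U` and `W` can be separated by a function `f ∈ 𝓕` with `f ≡ 0` on `W`, `f ≡ ε` on `U`
and `0 ≤ f ≤ ε`. -/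
theorem exists_separating_function
    {F : Type*} [Nonempty F] [MetricSpace F] [CompactSpace F]
    (Φ : ResistanceForm F) (hdist : ∀ x y : F, dist x y = Φ.Rmet x y)
    (U W : Set F) (hU : U.Nonempty) (hW : W.Nonempty)
    (hUc : IsCompact U) (hWc : IsCompact W) (hUW : Disjoint U W) :
    ∃ f ∈ Φ.dom, ∃ ε : ℝ, 0 < ε ∧ (∀ w ∈ W, f w = 0) ∧ (∀ u ∈ U, f u = ε) ∧
      ∀ z : F, 0 ≤ f z ∧ f z ≤ ε := by
  obtain ⟨g, hgW, hgU, -⟩ := exists_continuous_zero_one_of_isClosed hWc.isClosed hUc.isClosed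
    hUW.symm
  have hmem : (3 : ℝ) • g - 1 ∈ closure {g : C(F, ℝ) | ⇑g ∈ Φ.dom} := by
    rw [Φ.closure_setOf_mem_dom_eq_top hdist]
    trivial
  obtain ⟨f, hf, hfg⟩ := Metric.mem_closure_iff.1 hmem 1 one_pos
  have hclose : ∀ x, |3 * g x - 1 - f x| < 1 := fun x => by
    simpa [Real.dist_eq, sub_sub, add_comm] using (ContinuousMap.dist_apply_le_dist x).trans_lt hfg
  refine ⟨_, (Φ.rf5 f hf).1, 1, one_pos, fun w hw => ?_, fun u hu => ?_, fun z => ?_⟩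
  · have h := abs_lt.1 (hclose w)
    have h0 : g w = 0 := hgW hw
    exact max_eq_right ((min_le_left _ _).trans (by linarith))
  · have h := abs_lt.1 (hclose u)
    have h1 : g u = 1 := hgU hu
    have hfu : 1 ≤ f u := by linarith
    simp [hfu]
  · exact ⟨le_max_right _ _, max_le (min_le_right _ _) zero_le_one⟩
end

section
/- Let (M,d_M) and (N,d_N) be metric spaces, let F ⊆ M be a compact subset and (F_n)_{n≥1} subsets of M, let φ : F → N be continuous and φ_n : F_n → N be maps, and suppose that for each n there is a correspondence 𝒞_n between F and F_n such that ε_n¹ := sup_{(x,y)∈𝒞_n} d_M(x,y) → 0 and ε_n² := sup_{(x,y)∈𝒞_n} d_N(φ(x),φ_n(y)) → 0 as n → ∞. If x_n ∈ F_n and x ∈ F satisfy d_M(x_n,x) → 0, then d_N(φ_n(x_n), φ(x)) → 0. -/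
open Filter Topology

/-- if `𝒞_n` are correspondences between a compact `F ⊆ M` and `F_n ⊆ M`
with distortions `ε_n¹ := sup_{(x,y)∈𝒞_n} d_M(x,y) → 0` and
`ε_n² := sup_{(x,y)∈𝒞_n} d_N(φ(x),φ_n(y)) → 0`, `φ` is continuous on `F`,
and `x_n ∈ F_n` converges to `x ∈ F`, then `φ_n(x_n) → φ(x)`. -/
theorem spatial_embeddings_pointwise_convergence
    {M N : Type*} [MetricSpace M] [MetricSpace N]
    (F : Set M) (hF : IsCompact F) (Fn : ℕ → Set M)
    (φ : M → N) (hφ : ContinuousOn φ F) (φn : ℕ → M → N)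
    (C : ℕ → Set (M × M)) (hCsub : ∀ n, C n ⊆ F ×ˢ Fn n)
    (hC1 : ∀ n, ∀ x ∈ F, ∃ y ∈ Fn n, (x, y) ∈ C n)
    (hC2 : ∀ n, ∀ y ∈ Fn n, ∃ x ∈ F, (x, y) ∈ C n)
    (ε1 ε2 : ℕ → ℝ)
    (hε1 : ∀ n, ∀ p ∈ C n, dist p.1 p.2 ≤ ε1 n)
    (hε2 : ∀ n, ∀ p ∈ C n, dist (φ p.1) (φn n p.2) ≤ ε2 n)
    (hε1lim : Tendsto ε1 atTop (𝓝 0)) (hε2lim : Tendsto ε2 atTop (𝓝 0))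
    (xn : ℕ → M) (hxn : ∀ n, xn n ∈ Fn n) (x : M) (hx : x ∈ F)
    (hconv : Tendsto (fun n => dist (xn n) x) atTop (𝓝 0)) :
    Tendsto (fun n => dist (φn n (xn n)) (φ x)) atTop (𝓝 0) := by
  choose z hzF hzC using fun n => hC2 n (xn n) (hxn n)
  have hz : Tendsto z atTop (𝓝 x) := by
    rw [tendsto_iff_dist_tendsto_zero]
    refine squeeze_zero (fun _ => dist_nonneg) (fun n => ?_) (by simpa using hε1lim.add hconv)
    exact (dist_triangle _ (xn n) _).trans (add_le_add (hε1 n _ (hzC n)) le_rfl)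
  have hφz : Tendsto (fun n => dist (φ (z n)) (φ x)) atTop (𝓝 0) :=
    tendsto_iff_dist_tendsto_zero.1 <| (hφ x hx).tendsto.comp <|
      tendsto_nhdsWithin_iff.2 ⟨hz, .of_forall hzF⟩
  refine squeeze_zero (fun _ => dist_nonneg) (fun n => ?_) (by simpa using hε2lim.add hφz)
  refine (dist_triangle_left _ _ (φ (z n))).trans (add_le_add ?_ le_rfl)
  exact hε2 n _ (hzC n)
end

section
/- Let (M,d_M) and (N,d_N) be metric spaces, let F ⊆ M be a compact subset and (F_n)_{n≥1} subsets of M, let φ : F → N be continuous and φ_n : F_n → N be maps, and suppose that for each n there is a correspondence 𝒞_n between F and F_n such that ε_n¹ := sup_{(x,y)∈𝒞_n} d_M(x,y) → 0 and ε_n² := sup_{(x,y)∈𝒞_n} d_N(φ(x),φ_n(y)) → 0 as n → ∞. Then the maps φ_n are asymptotically equicontinuous: lim_{δ→0} limsup_{n→∞} sup{ d_N(φ_n(x),φ_n(y)) : x,y ∈ F_n, d_M(x,y) ≤ δ } = 0. -/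
open Filter Topology

/-- if `𝒞_n` are correspondences between a compact `F ⊆ M` and `F_n ⊆ M`
with distortions `ε_n¹ := sup_{(x,y)∈𝒞_n} d_M(x,y) → 0` and
`ε_n² := sup_{(x,y)∈𝒞_n} d_N(φ(x),φ_n(y)) → 0`, and `φ` is continuous on `F`, then the
maps `φ_n` are asymptotically equicontinuous:
`lim_{δ→0} limsup_n sup{ d_N(φ_n(x),φ_n(y)) : x,y ∈ F_n, d_M(x,y) ≤ δ } = 0`. -/
theorem spatial_embeddings_equicontinuity
    {M N : Type*} [MetricSpace M] [MetricSpace N]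
    (F : Set M) (hF : IsCompact F) (Fn : ℕ → Set M)
    (φ : M → N) (hφ : ContinuousOn φ F) (φn : ℕ → M → N)
    (C : ℕ → Set (M × M)) (hCsub : ∀ n, C n ⊆ F ×ˢ Fn n)
    (hC1 : ∀ n, ∀ x ∈ F, ∃ y ∈ Fn n, (x, y) ∈ C n)
    (hC2 : ∀ n, ∀ y ∈ Fn n, ∃ x ∈ F, (x, y) ∈ C n)
    (ε1 ε2 : ℕ → ℝ)
    (hε1 : ∀ n, ∀ p ∈ C n, dist p.1 p.2 ≤ ε1 n)
    (hε2 : ∀ n, ∀ p ∈ C n, dist (φ p.1) (φn n p.2) ≤ ε2 n)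
    (hε1lim : Tendsto ε1 atTop (𝓝 0)) (hε2lim : Tendsto ε2 atTop (𝓝 0)) :
    ∀ η > (0:ℝ), ∃ δ > (0:ℝ), ∃ N₀ : ℕ, ∀ n ≥ N₀, ∀ x ∈ Fn n, ∀ y ∈ Fn n,
      dist x y ≤ δ → dist (φn n x) (φn n y) ≤ η := by
  intro η hη
  have huc : UniformContinuousOn φ F := hF.uniformContinuousOn_of_continuous hφ
  obtain ⟨r, hr, hφr⟩ := Metric.uniformContinuousOn_iff.1 huc (η / 3) (by positivity)
  have h1 : ∀ᶠ n in atTop, ε1 n < r / 3 := hε1lim.eventually_lt_const (by positivity)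
  have h2 : ∀ᶠ n in atTop, ε2 n < η / 3 := hε2lim.eventually_lt_const (by positivity)
  obtain ⟨N₀, hN₀⟩ := eventually_atTop.1 (h1.and h2)
  refine ⟨r / 4, by positivity, N₀, fun n hn x hx y hy hxy => ?_⟩
  obtain ⟨hn1, hn2⟩ := hN₀ n hn
  obtain ⟨x', hx'F, hx'C⟩ := hC2 n x hx
  obtain ⟨y', hy'F, hy'C⟩ := hC2 n y hy
  have hx1 : dist x' x ≤ ε1 n := hε1 n _ hx'C
  have hy1 : dist y' y ≤ ε1 n := hε1 n _ hy'C
  have hx2 : dist (φ x') (φn n x) ≤ ε2 n := hε2 n _ hx'C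
  have hy2 : dist (φ y') (φn n y) ≤ ε2 n := hε2 n _ hy'C
  have hM := dist_triangle4 x' x y y'
  rw [dist_comm y y'] at hM
  have hφxy := hφr x' hx'F y' hy'F (by linarith)
  have hN := dist_triangle4 (φn n x) (φ x') (φ y') (φn n y)
  rw [dist_comm (φn n x) (φ x')] at hN
  linarith
end
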